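/- arXiv:2003.00078 — 8 statements merged into one kernel-verified Lean document; each statement's English description precedes it below -/
import Mathlib

section
/- Let Σ be a positive definite q×q real matrix satisfying the penalized M-estimating equation Σ = (1/n) ∑_{i=1}^n u(xᵢᵀ Σ⁻¹ xᵢ) xᵢ xᵢᵀ + η I_q, where η ≥ 0, u(s) ≥ 0 for all s ≥ 0, and s·u(s) ≤ κ for all s > 0 with 0 ≤ κ < 1. Then Σ ≤ (η/(1−κ)) I_q in the Loewner order. -/
open Matrix

/-- Cauchy–Schwarz inequality for the dual pair of quadratic forms given by `S` and `S⁻¹`. -/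
theorem Matrix.PosDef.dotProduct_sq_le {ι : Type*} [Fintype ι] [DecidableEq ι]
    {S : Matrix ι ι ℝ} (hS : S.PosDef) (v x : ι → ℝ) :
    (v ⬝ᵥ x) ^ 2 ≤ (v ⬝ᵥ S *ᵥ v) * (x ⬝ᵥ S⁻¹ *ᵥ x) := by
  have hx : S *ᵥ (S⁻¹ *ᵥ x) = x := by
    rw [mulVec_mulVec, mul_nonsing_inv _ ((isUnit_iff_isUnit_det _).mp hS.isUnit), one_mulVec]
  have hsymm : (S⁻¹ *ᵥ x) ⬝ᵥ S *ᵥ v = v ⬝ᵥ x := by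
    have hT : Sᵀ = S := by simpa [IsSymm] using hS.isHermitian.eq
    rw [dotProduct_mulVec, ← mulVec_transpose, hT, hx, dotProduct_comm]
  have hquad (t : ℝ) :
      0 ≤ (x ⬝ᵥ S⁻¹ *ᵥ x) * (t * t) + (-2 * (v ⬝ᵥ x)) * t + v ⬝ᵥ S *ᵥ v := by
    have h := hS.posSemidef.dotProduct_mulVec_nonneg (v - t • (S⁻¹ *ᵥ x))
    simp only [star_trivial, mulVec_sub, mulVec_smul, hx, sub_dotProduct, dotProduct_sub,
      smul_dotProduct, dotProduct_smul, hsymm, smul_eq_mul] at h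
    rw [dotProduct_comm (S⁻¹ *ᵥ x) x] at h
    linarith
  have h := discrim_le_zero hquad
  rw [discrim] at h
  linarith

/-- If a positive definite `S` satisfies the penalized M-estimating equation
`S = (1/n) ∑ u(xᵢᵀ S⁻¹ xᵢ) xᵢxᵢᵀ + η I` with `η ≥ 0`, `u ≥ 0` on `[0,∞)`, and
`s·u(s) ≤ κ` for all `s > 0` with `0 ≤ κ < 1`, then `S ≤ (η/(1-κ)) I`. -/
theorem penalized_M_upper_bound
    (q n : ℕ) (hq : 0 < q) (hn : 0 < n)
    (x : Fin n → Fin q → ℝ) (u : ℝ → ℝ) (η : ℝ) (hη : 0 ≤ η)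
    (κ : ℝ) (hκ0 : 0 ≤ κ) (hκ1 : κ < 1)
    (hu : ∀ s : ℝ, 0 ≤ s → 0 ≤ u s)
    (hψ : ∀ s : ℝ, 0 < s → s * u s ≤ κ)
    (S : Matrix (Fin q) (Fin q) ℝ) (hS : S.PosDef)
    (heq : S = (1 / (n : ℝ)) •
        (∑ i : Fin n, u (x i ⬝ᵥ S⁻¹ *ᵥ x i) • vecMulVec (x i) (x i))
        + η • (1 : Matrix (Fin q) (Fin q) ℝ)) :
    ((η / (1 - κ)) • (1 : Matrix (Fin q) (Fin q) ℝ) - S).PosSemidef := by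
  refine PosSemidef.of_dotProduct_mulVec_nonneg
    ((isHermitian_one.smul (IsSelfAdjoint.all _)).sub hS.isHermitian) fun v ↦ ?_
  have ha : 0 ≤ v ⬝ᵥ S *ᵥ v := by simpa using hS.posSemidef.dotProduct_mulVec_nonneg v
  have hterm (i : Fin n) :
      u (x i ⬝ᵥ S⁻¹ *ᵥ x i) * (v ⬝ᵥ x i) ^ 2 ≤ κ * (v ⬝ᵥ S *ᵥ v) := by
    have hcs := hS.dotProduct_sq_le v (x i)
    have hs : 0 ≤ x i ⬝ᵥ S⁻¹ *ᵥ x i := by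
      simpa using hS.inv.posSemidef.dotProduct_mulVec_nonneg (x i)
    have h1 := mul_le_mul_of_nonneg_left hcs (hu _ hs)
    rcases hs.eq_or_lt with h0 | hpos
    · rw [← h0] at h1 ⊢
      nlinarith [mul_nonneg hκ0 ha]
    · nlinarith [mul_le_mul_of_nonneg_right (hψ _ hpos) ha]
  have hform : v ⬝ᵥ S *ᵥ v =
      (1 / (n : ℝ)) * ∑ i, u (x i ⬝ᵥ S⁻¹ *ᵥ x i) * (v ⬝ᵥ x i) ^ 2 + η * (v ⬝ᵥ v) := by
    have h := congrArg (fun M ↦ v ⬝ᵥ M *ᵥ v) heq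
    simp only [add_mulVec, smul_mulVec, sum_mulVec, one_mulVec, vecMulVec_mulVec,
      dotProduct_add, dotProduct_smul, dotProduct_sum, smul_eq_mul, op_smul_eq_smul] at h
    rw [h]
    simp only [dotProduct_comm _ v, sq]
  have hsum : (1 / (n : ℝ)) * ∑ i, u (x i ⬝ᵥ S⁻¹ *ᵥ x i) * (v ⬝ᵥ x i) ^ 2 ≤
      κ * (v ⬝ᵥ S *ᵥ v) := by
    have hn' : (0 : ℝ) < n := Nat.cast_pos.mpr hn
    rw [one_div, inv_mul_le_iff₀ hn']
    simpa using Finset.sum_le_sum fun i (_ : i ∈ Finset.univ) ↦ hterm i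
  have hκ : 0 < 1 - κ := sub_pos.mpr hκ1
  have hbound : v ⬝ᵥ S *ᵥ v ≤ η / (1 - κ) * (v ⬝ᵥ v) := by
    rw [div_mul_eq_mul_div, le_div_iff₀ hκ]
    linarith
  simpa [sub_mulVec, smul_mulVec, dotProduct_sub] using hbound
end

section
/- Let Σ be a positive definite q×q real matrix satisfying the Kullback–Leibler penalized M-estimating equation Σ = (1−γ)·(1/n) ∑_{i=1}^n u(xᵢᵀ Σ⁻¹ xᵢ) xᵢ xᵢᵀ + γ I_q, where 0 < γ ≤ 1, u(s) ≥ 0 for all s ≥ 0, and s·u(s) ≤ κ for all s > 0 with κ ≥ 0 satisfying (1−γ)κ < 1. Then γ I_q ≤ Σ ≤ (γ/(1−(1−γ)κ)) I_q in the Loewner order. -/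
open Matrix

/-- The Cauchy–Schwarz inequality for a positive definite matrix, in Loewner form. -/
theorem Matrix.PosDef.posSemidef_smul_sub_vecMulVec {ι : Type*} [Fintype ι] [DecidableEq ι]
    {S : Matrix ι ι ℝ} (hS : S.PosDef) (a : ι → ℝ) :
    ((a ⬝ᵥ S⁻¹ *ᵥ a) • S - vecMulVec a a).PosSemidef := by
  have hvec : (vecMulVec a a).PosSemidef := by
    simpa using posSemidef_vecMulVec_self_star a
  refine .of_dotProduct_mulVec_nonneg
    ((hS.isHermitian.smul (IsSelfAdjoint.all _)).sub hvec.isHermitian) fun v ↦ ?_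
  by_cases ha : a = 0
  · simp [ha]
  have hs : 0 < a ⬝ᵥ S⁻¹ *ᵥ a := by simpa using hS.inv.dotProduct_mulVec_pos ha
  have hSa : S *ᵥ (S⁻¹ *ᵥ a) = a := by
    rw [mulVec_mulVec, mul_nonsing_inv _ ((isUnit_iff_isUnit_det S).mp hS.isUnit), one_mulVec]
  have hT : Sᵀ = S := by simpa [IsHermitian] using hS.isHermitian
  have hcross : (S⁻¹ *ᵥ a) ⬝ᵥ S *ᵥ v = a ⬝ᵥ v := by
    rw [dotProduct_mulVec, ← mulVec_transpose, hT, hSa]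
  have key := hS.posSemidef.dotProduct_mulVec_nonneg
    ((a ⬝ᵥ S⁻¹ *ᵥ a) • v - (a ⬝ᵥ v) • (S⁻¹ *ᵥ a))
  simp only [star_trivial, mulVec_sub, mulVec_smul, hSa, sub_dotProduct, dotProduct_sub,
    smul_dotProduct, dotProduct_smul, smul_eq_mul, hcross, dotProduct_comm v a,
    dotProduct_comm (S⁻¹ *ᵥ a) a] at key
  simp only [star_trivial, sub_mulVec, smul_mulVec, vecMulVec_mulVec, dotProduct_sub,
    dotProduct_smul, smul_eq_mul, op_smul_eq_smul, dotProduct_comm v a]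
  refine (mul_nonneg_iff_of_pos_left hs).mp ?_
  linarith

/-- A rank-one term of the M-estimating sum is at most `κ S` when `s * u s ≤ κ`. -/
theorem Matrix.PosDef.posSemidef_smul_sub_weight_smul_vecMulVec {ι : Type*} [Fintype ι]
    [DecidableEq ι] {S : Matrix ι ι ℝ} (hS : S.PosDef) {u : ℝ → ℝ} {κ : ℝ} (hκ0 : 0 ≤ κ)
    (hu : ∀ s : ℝ, 0 ≤ s → 0 ≤ u s) (hψ : ∀ s : ℝ, 0 < s → s * u s ≤ κ) (a : ι → ℝ) :
    (κ • S - u (a ⬝ᵥ S⁻¹ *ᵥ a) • vecMulVec a a).PosSemidef := by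
  have hs : 0 ≤ a ⬝ᵥ S⁻¹ *ᵥ a := by
    simpa using hS.inv.posSemidef.dotProduct_mulVec_nonneg a
  have hle : (a ⬝ᵥ S⁻¹ *ᵥ a) * u (a ⬝ᵥ S⁻¹ *ᵥ a) ≤ κ := by
    rcases hs.eq_or_lt with h | h
    · simpa [← h] using hκ0
    · exact hψ _ h
  convert (hS.posSemidef.smul (sub_nonneg.mpr hle)).add
    ((hS.posSemidef_smul_sub_vecMulVec a).smul (hu _ hs)) using 1
  module

/-- If a positive definite `S` satisfies the Kullback–Leibler penalized
M-estimating equation `S = (1-γ)·(1/n) ∑ u(xᵢᵀ S⁻¹ xᵢ) xᵢxᵢᵀ + γ I` with `0 < γ ≤ 1`,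
`u ≥ 0` on `[0,∞)`, and `s·u(s) ≤ κ` for all `s > 0` with `κ ≥ 0`, `(1-γ)κ < 1`,
then `γ I ≤ S ≤ (γ/(1-(1-γ)κ)) I`. -/
theorem KL_penalized_M_bounds
    (q n : ℕ) (hq : 0 < q) (hn : 0 < n)
    (x : Fin n → Fin q → ℝ) (u : ℝ → ℝ)
    (γ : ℝ) (hγ0 : 0 < γ) (hγ1 : γ ≤ 1)
    (κ : ℝ) (hκ0 : 0 ≤ κ) (hκ1 : (1 - γ) * κ < 1)
    (hu : ∀ s : ℝ, 0 ≤ s → 0 ≤ u s)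
    (hψ : ∀ s : ℝ, 0 < s → s * u s ≤ κ)
    (S : Matrix (Fin q) (Fin q) ℝ) (hS : S.PosDef)
    (heq : S = (1 - γ) • ((1 / (n : ℝ)) •
        (∑ i : Fin n, u (x i ⬝ᵥ S⁻¹ *ᵥ x i) • vecMulVec (x i) (x i)))
        + γ • (1 : Matrix (Fin q) (Fin q) ℝ)) :
    (S - γ • (1 : Matrix (Fin q) (Fin q) ℝ)).PosSemidef ∧
      ((γ / (1 - (1 - γ) * κ)) • (1 : Matrix (Fin q) (Fin q) ℝ) - S).PosSemidef := by
  have hn' : (n : ℝ) ≠ 0 := by positivity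
  have hγ' : 0 ≤ 1 - γ := sub_nonneg.mpr hγ1
  have hc : 0 < 1 - (1 - γ) * κ := sub_pos.mpr hκ1
  set M : Matrix (Fin q) (Fin q) ℝ := (1 / (n : ℝ)) •
    ∑ i : Fin n, u (x i ⬝ᵥ S⁻¹ *ᵥ x i) • vecMulVec (x i) (x i) with hM
  have hn0 : 0 ≤ 1 / (n : ℝ) := by positivity
  have hMpos : M.PosSemidef := by
    refine (posSemidef_sum _ fun i _ ↦ ?_).smul hn0
    have hs : 0 ≤ x i ⬝ᵥ S⁻¹ *ᵥ x i := by
      simpa using hS.inv.posSemidef.dotProduct_mulVec_nonneg (x i)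
    have hvec : (vecMulVec (x i) (x i)).PosSemidef := by
      simpa using posSemidef_vecMulVec_self_star (x i)
    exact hvec.smul (hu _ hs)
  have hMle : (κ • S - M).PosSemidef := by
    have h := (posSemidef_sum Finset.univ fun i _ ↦
      hS.posSemidef_smul_sub_weight_smul_vecMulVec hκ0 hu hψ (x i)).smul hn0
    convert h using 1
    rw [Finset.sum_sub_distrib, smul_sub, ← hM, Finset.sum_const, Finset.card_univ,
      Fintype.card_fin, ← Nat.cast_smul_eq_nsmul ℝ, smul_smul, one_div_mul_cancel hn', one_smul]
  constructor
  · rw [sub_eq_of_eq_add heq]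
    exact hMpos.smul hγ'
  · have h := (hMle.smul hγ').smul (inv_nonneg.mpr hc.le)
    convert h using 1
    have hγI : γ • (1 : Matrix (Fin q) (Fin q) ℝ) = S - (1 - γ) • M :=
      eq_sub_of_add_eq' heq.symm
    have hSc : S = (1 - (1 - γ) * κ)⁻¹ • ((1 - (1 - γ) * κ) • S) :=
      (inv_smul_smul₀ hc.ne' S).symm
    rw [div_eq_inv_mul, mul_smul, hγI]
    nth_rewrite 2 [hSc]
    rw [← smul_sub]
    congr 1
    module
end

section
/- Let Σ be a positive definite q×q real matrix satisfying the penalized M-estimating equation Σ = (1/n) ∑_{i=1}^n u(xᵢᵀ Σ⁻¹ xᵢ) xᵢ xᵢᵀ + η I_q, where η ≥ 0, u(s) ≥ 0 for all s ≥ 0, and s·u(s) ≤ κ for all s > 0 with κ ≥ 0. Let λ₁ denote the largest eigenvalue of Σ. Then Σ ≤ (κ λ₁ + η) I_q in the Loewner order; in particular λ₁ ≤ κ λ₁ + η. -/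
open Matrix
open scoped Pointwise

/-- A real Hermitian matrix lies below `c • 1` in the Loewner order iff its eigenvalues are at
most `c`. -/
theorem Matrix.IsHermitian.smul_one_sub_posSemidef_iff {m : Type*} [Fintype m] [DecidableEq m]
    {A : Matrix m m ℝ} (hA : A.IsHermitian) (c : ℝ) :
    (c • (1 : Matrix m m ℝ) - A).PosSemidef ↔ ∀ i, hA.eigenvalues i ≤ c := by
  have hherm : (c • (1 : Matrix m m ℝ) - A).IsHermitian :=
    (isHermitian_one.smul (IsSelfAdjoint.all c)).sub hA
  have hspec : spectrum ℝ (c • (1 : Matrix m m ℝ) - A) = ({c} : Set ℝ) - Set.range hA.eigenvalues := by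
    rw [← hA.spectrum_real_eq_range_eigenvalues, spectrum.singleton_sub_eq,
      Algebra.algebraMap_eq_smul_one]
  rw [posSemidef_iff_isHermitian_and_spectrum_nonneg, and_iff_right hherm, hspec]
  simp [Set.subset_def]

/-- Cauchy–Schwarz inequality for the dual pair of quadratic forms of `A` and `A⁻¹`. -/
theorem Matrix.PosDef.sq_dotProduct_le {m : Type*} [Fintype m] [DecidableEq m]
    {A : Matrix m m ℝ} (hA : A.PosDef) (x v : m → ℝ) :
    (x ⬝ᵥ v) ^ 2 ≤ (x ⬝ᵥ A⁻¹ *ᵥ x) * (v ⬝ᵥ A *ᵥ v) := by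
  have hAx : A *ᵥ (A⁻¹ *ᵥ x) = x := by
    rw [mulVec_mulVec, mul_nonsing_inv _ ((isUnit_iff_isUnit_det A).mp hA.isUnit), one_mulVec]
  have hsymm : (A⁻¹ *ᵥ x) ⬝ᵥ A *ᵥ v = x ⬝ᵥ v := by
    have hT : Aᵀ = A := by simpa using hA.1.eq
    rw [dotProduct_mulVec, ← mulVec_transpose, hT, hAx]
  have h : ∀ t : ℝ, 0 ≤ (x ⬝ᵥ A⁻¹ *ᵥ x) * (t * t) + (2 * (x ⬝ᵥ v)) * t + v ⬝ᵥ A *ᵥ v := by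
    intro t
    have h0 := hA.posSemidef.dotProduct_mulVec_nonneg (t • (A⁻¹ *ᵥ x) + v)
    simp only [star_trivial, mulVec_add, mulVec_smul, hAx, dotProduct_add, add_dotProduct,
      smul_dotProduct, dotProduct_smul, hsymm, smul_eq_mul] at h0
    rw [dotProduct_comm (A⁻¹ *ᵥ x) x, dotProduct_comm v x] at h0
    linarith
  have hd := discrim_le_zero h
  rw [discrim] at hd
  linarith

/-- If a positive definite `S` satisfies the penalized M-estimating equation
`S = (1/n) ∑ u(xᵢᵀ S⁻¹ xᵢ) xᵢxᵢᵀ + η I` with `η ≥ 0`, `u ≥ 0` on `[0,∞)`, and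
`s·u(s) ≤ κ` for all `s > 0` with `κ ≥ 0`, and `lam₁` is the largest eigenvalue of `S`,
then `S ≤ (κ lam₁ + η) I`; in particular `lam₁ ≤ κ lam₁ + η`. -/
theorem penalized_M_eigenvalue_bound
    (q n : ℕ) (hq : 0 < q) (hn : 0 < n)
    (x : Fin n → Fin q → ℝ) (u : ℝ → ℝ) (η : ℝ) (hη : 0 ≤ η)
    (κ : ℝ) (hκ0 : 0 ≤ κ)
    (hu : ∀ s : ℝ, 0 ≤ s → 0 ≤ u s)
    (hψ : ∀ s : ℝ, 0 < s → s * u s ≤ κ)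
    (S : Matrix (Fin q) (Fin q) ℝ) (hS : S.PosDef)
    (lam₁ : ℝ) (hlam₁ : IsGreatest (Set.range hS.1.eigenvalues) lam₁)
    (heq : S = (1 / (n : ℝ)) •
        (∑ i : Fin n, u (x i ⬝ᵥ S⁻¹ *ᵥ x i) • vecMulVec (x i) (x i))
        + η • (1 : Matrix (Fin q) (Fin q) ℝ)) :
    ((κ * lam₁ + η) • (1 : Matrix (Fin q) (Fin q) ℝ) - S).PosSemidef ∧
      lam₁ ≤ κ * lam₁ + η := by
  have hSle := (hS.1.smul_one_sub_posSemidef_iff lam₁).mpr fun i => hlam₁.2 ⟨i, rfl⟩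
  have hweight : ∀ (v : Fin q → ℝ) (i : Fin n),
      u (x i ⬝ᵥ S⁻¹ *ᵥ x i) * (x i ⬝ᵥ v) ^ 2 ≤ κ * (v ⬝ᵥ S *ᵥ v) := by
    intro v i
    have hv : 0 ≤ v ⬝ᵥ S *ᵥ v := by simpa using hS.posSemidef.dotProduct_mulVec_nonneg v
    rcases eq_or_ne (x i) 0 with hx | hx
    · simpa [hx] using mul_nonneg hκ0 hv
    · have hs : 0 < x i ⬝ᵥ S⁻¹ *ᵥ x i := by simpa using hS.inv.dotProduct_mulVec_pos hx
      calc u (x i ⬝ᵥ S⁻¹ *ᵥ x i) * (x i ⬝ᵥ v) ^ 2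
          ≤ u (x i ⬝ᵥ S⁻¹ *ᵥ x i) * ((x i ⬝ᵥ S⁻¹ *ᵥ x i) * (v ⬝ᵥ S *ᵥ v)) :=
            mul_le_mul_of_nonneg_left (hS.sq_dotProduct_le _ _) (hu _ hs.le)
        _ = (x i ⬝ᵥ S⁻¹ *ᵥ x i) * u (x i ⬝ᵥ S⁻¹ *ᵥ x i) * (v ⬝ᵥ S *ᵥ v) := by ring
        _ ≤ κ * (v ⬝ᵥ S *ᵥ v) := mul_le_mul_of_nonneg_right (hψ _ hs) hv
  have hform : ∀ v : Fin q → ℝ, v ⬝ᵥ S *ᵥ v ≤ κ * (v ⬝ᵥ S *ᵥ v) + η * (v ⬝ᵥ v) := by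
    intro v
    have hexp : v ⬝ᵥ S *ᵥ v =
        (1 / (n : ℝ)) * ∑ i, u (x i ⬝ᵥ S⁻¹ *ᵥ x i) * (x i ⬝ᵥ v) ^ 2 + η * (v ⬝ᵥ v) := by
      conv_lhs => rw [heq]
      simp only [add_mulVec, smul_mulVec, sum_mulVec, vecMulVec_mulVec, one_mulVec,
        dotProduct_add, dotProduct_smul, dotProduct_sum, smul_eq_mul, op_smul_eq_smul]
      congr 2
      refine Finset.sum_congr rfl fun i _ => ?_
      rw [dotProduct_comm v (x i), sq]
    have hsum := Finset.sum_le_sum fun i (_ : i ∈ Finset.univ) => hweight v i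
    rw [Finset.sum_const, Finset.card_univ, Fintype.card_fin, nsmul_eq_mul] at hsum
    have hn' : (0 : ℝ) < n := Nat.cast_pos.mpr hn
    have havg : (1 / (n : ℝ)) * ∑ i, u (x i ⬝ᵥ S⁻¹ *ᵥ x i) * (x i ⬝ᵥ v) ^ 2
        ≤ κ * (v ⬝ᵥ S *ᵥ v) := by
      rw [one_div, inv_mul_le_iff₀ hn']
      exact hsum
    linarith
  have hmain : ((κ * lam₁ + η) • (1 : Matrix (Fin q) (Fin q) ℝ) - S).PosSemidef := by
    refine .of_dotProduct_mulVec_nonneg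
      ((isHermitian_one.smul (IsSelfAdjoint.all _)).sub hS.1) fun v => ?_
    have hle := hSle.dotProduct_mulVec_nonneg v
    simp only [star_trivial, sub_mulVec, smul_mulVec, one_mulVec, dotProduct_sub,
      dotProduct_smul, smul_eq_mul] at hle ⊢
    linarith [hform v, mul_nonneg hκ0 hle]
  obtain ⟨i, hi⟩ := hlam₁.1
  exact ⟨hmain, hi ▸ (hS.1.smul_one_sub_posSemidef_iff _).mp hmain i⟩
end

section
/- Let z₁, …, z_N ∈ ℝ^q be nonzero vectors and let V be a positive semidefinite q×q real matrix with smallest eigenvalue λ_q, satisfying the hybrid M-estimating equation V = (1/N) ∑_{i=1}^N u(zᵢᵀ (V + η I_q)⁻¹ zᵢ) zᵢ zᵢᵀ, where η > 0 and u : ℝ → ℝ is non-increasing on (0,∞) with u(s) ≥ 0 for s > 0. Then V ≥ ((λ_q + η)/N) ∑_{i=1}^N ψ(zᵢᵀ zᵢ / (λ_q + η)) · (zᵢ zᵢᵀ)/(zᵢᵀ zᵢ) in the Loewner order, where ψ(s) = s·u(s). -/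
open Matrix

/-- A real symmetric matrix dominates any lower bound of its eigenvalues times the identity. -/
theorem Matrix.IsHermitian.posSemidef_sub_smul_one {n : Type*} [Fintype n] [DecidableEq n]
    {A : Matrix n n ℝ} (hA : A.IsHermitian) {c : ℝ} (hc : ∀ i, c ≤ hA.eigenvalues i) :
    (A - c • (1 : Matrix n n ℝ)).PosSemidef := by
  have h : A - c • (1 : Matrix n n ℝ) =
      Unitary.conjStarAlgAut ℝ _ hA.eigenvectorUnitary
        (diagonal fun i => hA.eigenvalues i - c) := by
    have hd : (diagonal fun i => hA.eigenvalues i - c) =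
        diagonal (RCLike.ofReal ∘ hA.eigenvalues) - c • (1 : Matrix n n ℝ) := by
      ext i j
      by_cases hij : i = j <;> simp [hij]
    rw [hd, map_sub, map_smul, map_one, ← hA.spectral_theorem]
  rw [h]
  simpa [Unitary.isUnit_coe.posSemidef_star_right_conjugate_iff, posSemidef_diagonal_iff]
    using hc

/-- If `c • 1 ≤ W` with `0 < c`, then the quadratic form of `W⁻¹` is at most `c⁻¹` times the
squared Euclidean norm. -/
theorem Matrix.PosDef.dotProduct_inv_mulVec_le {n : Type*} [Fintype n] [DecidableEq n]
    {W : Matrix n n ℝ} (hW : W.PosDef) {c : ℝ} (hc : 0 < c)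
    (hWc : (W - c • (1 : Matrix n n ℝ)).PosSemidef) (z : n → ℝ) :
    z ⬝ᵥ W⁻¹ *ᵥ z ≤ z ⬝ᵥ z / c := by
  set x := W⁻¹ *ᵥ z with hx
  have hz : W *ᵥ x = z := by
    rw [hx, mulVec_mulVec, mul_nonsing_inv _ ((isUnit_iff_isUnit_det _).1 hW.isUnit), one_mulVec]
  have hlow : c * (x ⬝ᵥ x) ≤ z ⬝ᵥ x := by
    have h := hWc.dotProduct_mulVec_nonneg x
    simp only [star_trivial, sub_mulVec, smul_mulVec, one_mulVec, dotProduct_sub,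
      dotProduct_smul, smul_eq_mul, hz] at h
    rw [dotProduct_comm z x]
    linarith
  have hcs : (z ⬝ᵥ x) ^ 2 ≤ (z ⬝ᵥ z) * (x ⬝ᵥ x) := by
    simpa [dotProduct, sq] using Finset.sum_mul_sq_le_sq_mul_sq Finset.univ z x
  have hzz : 0 ≤ z ⬝ᵥ z := by simpa using dotProduct_star_self_nonneg z
  rw [le_div_iff₀ hc]
  by_contra! hlt
  have hpos : 0 < z ⬝ᵥ x := pos_of_mul_pos_left (hzz.trans_lt hlt) hc.le
  nlinarith [mul_le_mul_of_nonneg_left hlow hzz, mul_le_mul_of_nonneg_left hcs hc.le,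
    mul_lt_mul_of_pos_right hlt hpos]

/-- If a positive semidefinite `V` with smallest eigenvalue `lamq` satisfies the
hybrid M-estimating equation `V = (1/N) ∑ u(zᵢᵀ (V + η I)⁻¹ zᵢ) zᵢzᵢᵀ` with `η > 0` and
`u` non-increasing and nonnegative on `(0,∞)`, then
`V ≥ ((lamq + η)/N) ∑ ψ(zᵢᵀzᵢ/(lamq + η)) · zᵢzᵢᵀ/(zᵢᵀzᵢ)` where `ψ(s) = s·u(s)`. -/
theorem hybrid_M_lower_bound_psi
    (q N : ℕ) (hq : 0 < q) (hN : 0 < N)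
    (z : Fin N → Fin q → ℝ) (hz : ∀ i, z i ≠ 0)
    (u : ℝ → ℝ) (η : ℝ) (hη : 0 < η)
    (hu_anti : AntitoneOn u (Set.Ioi (0 : ℝ)))
    (hu_nonneg : ∀ s : ℝ, 0 < s → 0 ≤ u s)
    (V : Matrix (Fin q) (Fin q) ℝ) (hV : V.PosSemidef)
    (lamq : ℝ) (hlamq : IsLeast (Set.range hV.1.eigenvalues) lamq)
    (heq : V = (1 / (N : ℝ)) •
        (∑ i : Fin N,
          u (z i ⬝ᵥ (V + η • (1 : Matrix (Fin q) (Fin q) ℝ))⁻¹ *ᵥ z i) •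
            vecMulVec (z i) (z i))) :
    (V - ((lamq + η) / (N : ℝ)) •
        (∑ i : Fin N,
          ((z i ⬝ᵥ z i / (lamq + η) * u (z i ⬝ᵥ z i / (lamq + η))) / (z i ⬝ᵥ z i)) •
            vecMulVec (z i) (z i))).PosSemidef := by
  have hlam : 0 ≤ lamq := by
    obtain ⟨i, hi⟩ := hlamq.1
    exact hi ▸ hV.eigenvalues_nonneg i
  have hc : 0 < lamq + η := by linarith
  set W := V + η • (1 : Matrix (Fin q) (Fin q) ℝ) with hWdef
  have hW : W.PosDef := PosDef.posSemidef_add hV (PosDef.one.smul hη)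
  have hWc : (W - (lamq + η) • (1 : Matrix (Fin q) (Fin q) ℝ)).PosSemidef := by
    have h := hV.1.posSemidef_sub_smul_one fun i => hlamq.2 ⟨i, rfl⟩
    rwa [hWdef, add_smul, add_sub_add_right_eq_sub]
  have hzz : ∀ i, 0 < z i ⬝ᵥ z i := fun i => by
    simpa using dotProduct_star_self_pos_iff.2 (hz i)
  have hdiff : V - ((lamq + η) / (N : ℝ)) •
        (∑ i : Fin N,
          ((z i ⬝ᵥ z i / (lamq + η) * u (z i ⬝ᵥ z i / (lamq + η))) / (z i ⬝ᵥ z i)) •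
            vecMulVec (z i) (z i)) =
      ∑ i : Fin N, ((1 / (N : ℝ)) * (u (z i ⬝ᵥ W⁻¹ *ᵥ z i) - u (z i ⬝ᵥ z i / (lamq + η)))) •
        vecMulVec (z i) (z i) := by
    conv_lhs => rw [heq]
    rw [Finset.smul_sum, Finset.smul_sum, ← Finset.sum_sub_distrib]
    refine Finset.sum_congr rfl fun i _ => ?_
    rw [smul_smul, smul_smul, ← sub_smul]
    congr 1
    have := (hzz i).ne'
    field_simp
  rw [hdiff]
  refine posSemidef_sum _ fun i _ => PosSemidef.smul ?_ ?_
  · simpa using posSemidef_vecMulVec_self_star (z i)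
  · have hpos : 0 < z i ⬝ᵥ W⁻¹ *ᵥ z i := by
      simpa using hW.inv.dotProduct_mulVec_pos (hz i)
    have hle := hW.dotProduct_inv_mulVec_le hc hWc (z i)
    exact mul_nonneg (by positivity)
      (sub_nonneg.2 (hu_anti hpos (hpos.trans_le hle) hle))
end

section
/- Let x₁, …, xₙ ∈ ℝ^q be nonzero vectors (the good data) and let y₁, …, y_m ∈ ℝ^q be arbitrary nonzero vectors (the contamination), and set N = n + m. Suppose V is a positive semidefinite q×q real matrix satisfying the hybrid M-estimating equation V = (1/N) ∑_{z ∈ Z} u(zᵀ (V + η I_q)⁻¹ z) z zᵀ over the combined sample Z = {x₁,…,xₙ, y₁,…,y_m}, where η > 0 and u : ℝ → ℝ is non-increasing on (0,∞) with u(s) ≥ 0 for s > 0. Then V ≥ (1/N) ∑_{i=1}^n u(xᵢᵀ xᵢ / η) xᵢ xᵢᵀ in the Loewner order; in particular, this lower bound does not depend on the contamination y₁, …, y_m. -/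
open Matrix

/-- The ridge resolvent `(V + η I)⁻¹` of a positive semidefinite `V` is bounded by `η⁻¹ I`,
as a quadratic form. -/
theorem Matrix.PosSemidef.dotProduct_inv_add_smul_one_mulVec_le {ι : Type*} [Fintype ι]
    [DecidableEq ι] {V : Matrix ι ι ℝ} (hV : V.PosSemidef) {η : ℝ} (hη : 0 < η) (x : ι → ℝ) :
    x ⬝ᵥ (V + η • (1 : Matrix ι ι ℝ))⁻¹ *ᵥ x ≤ x ⬝ᵥ x / η := by
  have hM : (V + η • (1 : Matrix ι ι ℝ)).PosDef := PosDef.posSemidef_add hV (PosDef.one.smul hη)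
  set w := (V + η • (1 : Matrix ι ι ℝ))⁻¹ *ᵥ x with hw
  have hx : x = V *ᵥ w + η • w := by
    have h : (V + η • (1 : Matrix ι ι ℝ)) *ᵥ w = x := by
      rw [hw, mulVec_mulVec, mul_nonsing_inv _ ((isUnit_iff_isUnit_det _).1 hM.isUnit),
        one_mulVec]
    rw [← h, add_mulVec, smul_mulVec, one_mulVec]
  have hVw : 0 ≤ w ⬝ᵥ V *ᵥ w := by simpa using hV.dotProduct_mulVec_nonneg w
  have hsq : 0 ≤ V *ᵥ w ⬝ᵥ V *ᵥ w := by simpa using dotProduct_star_self_nonneg (V *ᵥ w)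
  rw [le_div_iff₀ hη]
  clear_value w
  subst hx
  simp only [add_dotProduct, dotProduct_add, smul_dotProduct, dotProduct_smul, smul_eq_mul,
    dotProduct_comm (V *ᵥ w) w]
  nlinarith [mul_nonneg hη.le hVw]

/-- If a positive semidefinite `V` satisfies the hybrid M-estimating equation
over the contaminated sample `Z = {x₁,…,xₙ} ∪ {y₁,…,y_m}` with `η > 0` and `u`
non-increasing and nonnegative on `(0,∞)`, then
`V ≥ (1/(n+m)) ∑_{i=1}^n u(xᵢᵀxᵢ/η) xᵢxᵢᵀ`, a bound free of the contamination `y`. -/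
theorem hybrid_M_contamination_lower_bound
    (q n m : ℕ) (hq : 0 < q) (hn : 0 < n)
    (x : Fin n → Fin q → ℝ) (hx : ∀ i, x i ≠ 0)
    (y : Fin m → Fin q → ℝ) (hy : ∀ j, y j ≠ 0)
    (u : ℝ → ℝ) (η : ℝ) (hη : 0 < η)
    (hu_anti : AntitoneOn u (Set.Ioi (0 : ℝ)))
    (hu_nonneg : ∀ s : ℝ, 0 < s → 0 ≤ u s)
    (V : Matrix (Fin q) (Fin q) ℝ) (hV : V.PosSemidef)
    (heq : V = (1 / ((n : ℝ) + m)) •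
        ((∑ i : Fin n,
            u (x i ⬝ᵥ (V + η • (1 : Matrix (Fin q) (Fin q) ℝ))⁻¹ *ᵥ x i) •
              vecMulVec (x i) (x i))
          + ∑ j : Fin m,
              u (y j ⬝ᵥ (V + η • (1 : Matrix (Fin q) (Fin q) ℝ))⁻¹ *ᵥ y j) •
                vecMulVec (y j) (y j))) :
    (V - (1 / ((n : ℝ) + m)) •
        (∑ i : Fin n, u (x i ⬝ᵥ x i / η) • vecMulVec (x i) (x i))).PosSemidef := by
  have hMinv : (V + η • (1 : Matrix (Fin q) (Fin q) ℝ))⁻¹.PosDef :=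
    (PosDef.posSemidef_add hV (PosDef.one.smul hη)).inv
  have hpos (z : Fin q → ℝ) (hz : z ≠ 0) :
      0 < z ⬝ᵥ (V + η • (1 : Matrix (Fin q) (Fin q) ℝ))⁻¹ *ᵥ z := by
    simpa using hMinv.dotProduct_mulVec_pos hz
  have hrank (z : Fin q → ℝ) : (vecMulVec z z).PosSemidef := by
    simpa using posSemidef_vecMulVec_self_star z
  have hle (i : Fin n) :
      u (x i ⬝ᵥ x i / η) ≤ u (x i ⬝ᵥ (V + η • (1 : Matrix (Fin q) (Fin q) ℝ))⁻¹ *ᵥ x i) := by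
    have h := hV.dotProduct_inv_add_smul_one_mulVec_le hη (x i)
    exact hu_anti (hpos _ (hx i)) ((hpos _ (hx i)).trans_le h) h
  have hc : 0 ≤ 1 / ((n : ℝ) + m) := by positivity
  have hdiff := congrArg
    (· - (1 / ((n : ℝ) + m)) • ∑ i : Fin n, u (x i ⬝ᵥ x i / η) • vecMulVec (x i) (x i)) heq
  simp only [← smul_sub, add_sub_right_comm, ← Finset.sum_sub_distrib, ← sub_smul] at hdiff
  rw [hdiff]
  exact ((posSemidef_sum _ fun i _ => (hrank _).smul (sub_nonneg.2 (hle i))).add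
    (posSemidef_sum _ fun j _ => (hrank _).smul (hu_nonneg _ (hpos _ (hy j))))).smul hc
end

section
/- Let V be a positive semidefinite q×q real matrix satisfying the hybrid M-estimating equation V = (1/n) ∑_{i=1}^n u(xᵢᵀ (V + η I_q)⁻¹ xᵢ) xᵢ xᵢᵀ, where η > 0, u(s) ≥ 0 for all s ≥ 0, and s·u(s) ≤ κ for all s > 0 with 0 ≤ κ < 1. Then 0 ≤ V ≤ (η κ/(1−κ)) I_q in the Loewner order. -/
open Matrix

/-- Cauchy–Schwarz for the dual quadratic forms of `W` and `W⁻¹`. -/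
lemma Matrix.PosDef.sq_dotProduct_le_s10 {ι : Type*} [Fintype ι] [DecidableEq ι]
    {W : Matrix ι ι ℝ} (hW : W.PosDef) (x y : ι → ℝ) :
    (y ⬝ᵥ x) ^ 2 ≤ (y ⬝ᵥ W *ᵥ y) * (x ⬝ᵥ W⁻¹ *ᵥ x) := by
  have hz : W *ᵥ (W⁻¹ *ᵥ x) = x := by
    rw [mulVec_mulVec, mul_nonsing_inv _ ((isUnit_iff_isUnit_det _).1 hW.isUnit), one_mulVec]
  have hWt : Wᵀ = W := by simpa using hW.isHermitian.eq
  have hsymm : (W⁻¹ *ᵥ x) ⬝ᵥ W *ᵥ y = y ⬝ᵥ x := by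
    rw [dotProduct_mulVec, ← mulVec_transpose, hWt, hz, dotProduct_comm]
  have key (t : ℝ) : 0 ≤ (x ⬝ᵥ W⁻¹ *ᵥ x) * (t * t) + (-2 * (y ⬝ᵥ x)) * t + y ⬝ᵥ W *ᵥ y := by
    have h := hW.posSemidef.dotProduct_mulVec_nonneg (y - t • (W⁻¹ *ᵥ x))
    simp only [star_trivial, mulVec_sub, mulVec_smul, hz, sub_dotProduct, dotProduct_sub,
      smul_dotProduct, dotProduct_smul, smul_eq_mul, hsymm] at h
    rw [dotProduct_comm (W⁻¹ *ᵥ x) x] at h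
    linarith
  have := discrim_le_zero key
  rw [discrim] at this
  linarith

/-- A weighted rank-one quadratic form is dominated by `κ W` when `s * u s ≤ κ`. -/
lemma Matrix.PosDef.weight_mul_sq_dotProduct_le {ι : Type*} [Fintype ι] [DecidableEq ι]
    {W : Matrix ι ι ℝ} (hW : W.PosDef) {u : ℝ → ℝ} {κ : ℝ} (hκ : 0 ≤ κ)
    (hu : ∀ s : ℝ, 0 ≤ s → 0 ≤ u s) (hψ : ∀ s : ℝ, 0 < s → s * u s ≤ κ) (x y : ι → ℝ) :
    u (x ⬝ᵥ W⁻¹ *ᵥ x) * (y ⬝ᵥ x) ^ 2 ≤ κ * (y ⬝ᵥ W *ᵥ y) := by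
  have hy : 0 ≤ y ⬝ᵥ W *ᵥ y := by simpa using hW.posSemidef.dotProduct_mulVec_nonneg y
  have hs : 0 ≤ x ⬝ᵥ W⁻¹ *ᵥ x := by
    simpa using hW.inv.posSemidef.dotProduct_mulVec_nonneg x
  have hcs := hW.sq_dotProduct_le_s10 x y
  rcases hs.eq_or_lt with h0 | hpos
  · rw [← h0, mul_zero] at hcs
    rw [le_antisymm hcs (sq_nonneg _), mul_zero]
    positivity
  · calc u (x ⬝ᵥ W⁻¹ *ᵥ x) * (y ⬝ᵥ x) ^ 2
        ≤ u (x ⬝ᵥ W⁻¹ *ᵥ x) * ((y ⬝ᵥ W *ᵥ y) * (x ⬝ᵥ W⁻¹ *ᵥ x)) :=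
          mul_le_mul_of_nonneg_left hcs (hu _ hs)
      _ = ((x ⬝ᵥ W⁻¹ *ᵥ x) * u (x ⬝ᵥ W⁻¹ *ᵥ x)) * (y ⬝ᵥ W *ᵥ y) := by ring
      _ ≤ κ * (y ⬝ᵥ W *ᵥ y) := mul_le_mul_of_nonneg_right (hψ _ hpos) hy

/-- If a positive semidefinite `V` satisfies the hybrid M-estimating equation
`V = (1/n) ∑ u(xᵢᵀ (V + η I)⁻¹ xᵢ) xᵢxᵢᵀ` with `η > 0`, `u ≥ 0` on `[0,∞)`, and
`s·u(s) ≤ κ` on `(0,∞)` with `0 ≤ κ < 1`, then `0 ≤ V ≤ (ηκ/(1-κ)) I`. -/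
theorem hybrid_M_upper_bound
    (q n : ℕ) (hq : 0 < q) (hn : 0 < n)
    (x : Fin n → Fin q → ℝ) (u : ℝ → ℝ) (η : ℝ) (hη : 0 < η)
    (κ : ℝ) (hκ0 : 0 ≤ κ) (hκ1 : κ < 1)
    (hu : ∀ s : ℝ, 0 ≤ s → 0 ≤ u s)
    (hψ : ∀ s : ℝ, 0 < s → s * u s ≤ κ)
    (V : Matrix (Fin q) (Fin q) ℝ) (hV : V.PosSemidef)
    (heq : V = (1 / (n : ℝ)) •
        (∑ i : Fin n,
          u (x i ⬝ᵥ (V + η • (1 : Matrix (Fin q) (Fin q) ℝ))⁻¹ *ᵥ x i) •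
            vecMulVec (x i) (x i))) :
    V.PosSemidef ∧
      ((η * κ / (1 - κ)) • (1 : Matrix (Fin q) (Fin q) ℝ) - V).PosSemidef := by
  refine ⟨hV, .of_dotProduct_mulVec_nonneg
    ((isHermitian_one.smul (IsSelfAdjoint.all _)).sub hV.isHermitian) fun y => ?_⟩
  set W := V + η • (1 : Matrix (Fin q) (Fin q) ℝ) with hWdef
  have hW : W.PosDef := PosDef.posSemidef_add hV (PosDef.one.smul hη)
  have hWy : y ⬝ᵥ W *ᵥ y = y ⬝ᵥ V *ᵥ y + η * (y ⬝ᵥ y) := by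
    simp [hWdef, add_mulVec, smul_mulVec]
  have hVy : y ⬝ᵥ V *ᵥ y
      = (1 / (n : ℝ)) * ∑ i, u (x i ⬝ᵥ W⁻¹ *ᵥ x i) * (y ⬝ᵥ x i) ^ 2 := by
    conv_lhs => rw [heq]
    simp only [smul_mulVec, sum_mulVec, vecMulVec_mulVec, dotProduct_smul, dotProduct_sum,
      smul_eq_mul, op_smul_eq_smul]
    congr 1
    refine Finset.sum_congr rfl fun i _ => ?_
    rw [dotProduct_comm (x i) y]
    ring
  have hn' : (0 : ℝ) < n := Nat.cast_pos.2 hn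
  have hle : y ⬝ᵥ V *ᵥ y ≤ κ * (y ⬝ᵥ W *ᵥ y) := by
    rw [hVy, one_div, inv_mul_le_iff₀ hn']
    refine (Finset.sum_le_card_nsmul _ _ _ fun i _ =>
      hW.weight_mul_sq_dotProduct_le hκ0 hu hψ (x i) y).trans_eq ?_
    simp
  have hκ : 0 < 1 - κ := sub_pos.2 hκ1
  simp only [star_trivial, sub_mulVec, smul_mulVec, one_mulVec, dotProduct_sub, dotProduct_smul,
    smul_eq_mul]
  rw [sub_nonneg, div_mul_eq_mul_div, le_div_iff₀ hκ]
  rw [hWy] at hle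
  linarith
end

section
/- Let x₁, …, xₙ ∈ ℝ^q be nonzero vectors that span ℝ^q, let 0 < γ < 1, and let u : ℝ → ℝ be non-increasing on (0,∞) with u(s) > 0 for all s > 0 and s·u(s) ≤ κ for all s > 0 with κ ≥ 0 satisfying (1−γ)κ < 1. Then there exists a constant c > 0, depending only on x₁, …, xₙ, γ, u and the contamination size m, such that for every choice of contamination points y₁, …, y_m ∈ ℝ^q and every positive semidefinite q×q matrix V satisfying the hybrid M-estimating equation V = (1/(n+m)) ∑_{z ∈ Z} u(zᵀ ((1−γ) V + γ I_q)⁻¹ z) z zᵀ over the combined sample Z = {x₁,…,xₙ, y₁,…,y_m}, one has c I_q ≤ V ≤ (γ κ/(1−(1−γ)κ)) I_q in the Loewner order. Hence this hybrid M-estimator cannot break down under contamination. -/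
open Matrix

theorem posSemidef_of_isSymm_of_forall_dotProduct {q : ℕ} {A : Matrix (Fin q) (Fin q) ℝ}
    (hA : Aᵀ = A) (h : ∀ v : Fin q → ℝ, 0 ≤ v ⬝ᵥ A *ᵥ v) : A.PosSemidef :=
  PosSemidef.of_dotProduct_mulVec_nonneg (by simpa [IsHermitian] using hA)
    fun v => by simpa using h v

/-- Spanning vectors with positive weights give a coercive quadratic form. -/
theorem exists_pos_mul_dotProduct_le_sum_sq {q n : ℕ} (hq : 0 < q)
    (x : Fin n → Fin q → ℝ) (hspan : Submodule.span ℝ (Set.range x) = ⊤)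
    (a : Fin n → ℝ) (ha : ∀ i, 0 < a i) :
    ∃ c : ℝ, 0 < c ∧ ∀ v : Fin q → ℝ, c * (v ⬝ᵥ v) ≤ ∑ i, a i * (x i ⬝ᵥ v) ^ 2 := by
  have hpos : ∀ v : Fin q → ℝ, v ≠ 0 → 0 < ∑ i, a i * (x i ⬝ᵥ v) ^ 2 := by
    intro v hv
    have hnonneg : ∀ i ∈ Finset.univ, 0 ≤ a i * (x i ⬝ᵥ v) ^ 2 :=
      fun i _ => mul_nonneg (ha i).le (sq_nonneg _)
    refine (Finset.sum_nonneg hnonneg).lt_of_ne' fun h0 => hv ?_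
    have hi : ∀ i, x i ⬝ᵥ v = 0 := fun i => by
      have := (Finset.sum_eq_zero_iff_of_nonneg hnonneg).1 h0 i (Finset.mem_univ i)
      simpa [(ha i).ne'] using this
    have hmem : v ∈ Submodule.span ℝ (Set.range x) := hspan ▸ Submodule.mem_top
    have hall : ∀ w ∈ Submodule.span ℝ (Set.range x), w ⬝ᵥ v = 0 := by
      intro w hw
      induction hw using Submodule.span_induction with
      | mem w hw => obtain ⟨i, rfl⟩ := hw; exact hi i
      | zero => simp
      | add w z _ _ hw hz => simp [add_dotProduct, hw, hz]
      | smul r w _ hw => simp [smul_dotProduct, hw]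
    exact dotProduct_self_eq_zero.1 (hall v hmem)
  have : Nonempty (Fin q) := ⟨⟨0, hq⟩⟩
  have hself : ∀ v : Fin q → ℝ, v ≠ 0 → 0 < v ⬝ᵥ v := fun v hv => by
    simpa using dotProduct_star_self_pos_iff.2 hv
  have hne : ∀ v ∈ Metric.sphere (0 : Fin q → ℝ) 1, v ≠ 0 := fun v hv =>
    ne_zero_of_mem_unit_sphere ⟨v, hv⟩
  obtain ⟨v₀, hv₀, hmin⟩ := (isCompact_sphere (0 : Fin q → ℝ) 1).exists_isMinOn
    (f := fun v => (∑ i, a i * (x i ⬝ᵥ v) ^ 2) / (v ⬝ᵥ v))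
    (NormedSpace.sphere_nonempty.2 zero_le_one)
    (ContinuousOn.div (by unfold dotProduct; fun_prop) (by unfold dotProduct; fun_prop)
      fun v hv => (hself v (hne v hv)).ne')
  refine ⟨_, div_pos (hpos v₀ (hne v₀ hv₀)) (hself v₀ (hne v₀ hv₀)), fun v => ?_⟩
  rcases eq_or_ne v 0 with rfl | hv
  · simp
  have hvn : ‖v‖ ≠ 0 := norm_ne_zero_iff.2 hv
  have hmem : ‖v‖⁻¹ • v ∈ Metric.sphere (0 : Fin q → ℝ) 1 := by
    simp [norm_smul, hvn]
  have h := hmin hmem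
  have hscale : (∑ i, a i * (x i ⬝ᵥ (‖v‖⁻¹ • v)) ^ 2) / ((‖v‖⁻¹ • v) ⬝ᵥ (‖v‖⁻¹ • v)) =
      (∑ i, a i * (x i ⬝ᵥ v) ^ 2) / (v ⬝ᵥ v) := by
    have hsum : ∑ i, a i * (x i ⬝ᵥ (‖v‖⁻¹ • v)) ^ 2 =
        (‖v‖⁻¹ * ‖v‖⁻¹) * ∑ i, a i * (x i ⬝ᵥ v) ^ 2 := by
      rw [Finset.mul_sum]
      refine Finset.sum_congr rfl fun i _ => ?_
      rw [dotProduct_smul, smul_eq_mul]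
      ring
    rw [hsum, smul_dotProduct, dotProduct_smul, smul_eq_mul, smul_eq_mul, ← mul_assoc]
    exact mul_div_mul_left _ _ (mul_ne_zero (inv_ne_zero hvn) (inv_ne_zero hvn))
  simp only [Set.mem_ofPred_eq] at h
  rw [hscale] at h
  exact (le_div_iff₀ (hself v hv)).1 h

theorem Matrix.PosDef.dotProduct_sq_le_s14 {q : ℕ} {W : Matrix (Fin q) (Fin q) ℝ} (hW : W.PosDef)
    (z v : Fin q → ℝ) : (z ⬝ᵥ v) ^ 2 ≤ (z ⬝ᵥ W⁻¹ *ᵥ z) * (v ⬝ᵥ W *ᵥ v) := by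
  rcases eq_or_ne z 0 with rfl | hz
  · simp
  have hs : 0 < z ⬝ᵥ W⁻¹ *ᵥ z := by simpa using hW.inv.dotProduct_mulVec_pos hz
  have hWw : W *ᵥ (W⁻¹ *ᵥ z) = z := by
    rw [mulVec_mulVec, mul_nonsing_inv _ ((isUnit_iff_isUnit_det W).1 hW.isUnit), one_mulVec]
  have hT : Wᵀ = W := by simpa [IsHermitian] using hW.isHermitian
  have hcross : (W⁻¹ *ᵥ z) ⬝ᵥ W *ᵥ v = z ⬝ᵥ v := by
    rw [dotProduct_mulVec, ← mulVec_transpose, hT, hWw]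
  have h := hW.posSemidef.dotProduct_mulVec_nonneg
    ((z ⬝ᵥ W⁻¹ *ᵥ z) • v - (z ⬝ᵥ v) • (W⁻¹ *ᵥ z))
  simp only [star_trivial, mulVec_sub, mulVec_smul, hWw, sub_dotProduct, dotProduct_sub,
    smul_dotProduct, dotProduct_smul, smul_eq_mul, hcross, dotProduct_comm v z,
    dotProduct_comm (W⁻¹ *ᵥ z) z] at h
  refine le_of_mul_le_mul_left ?_ hs
  linarith

theorem Matrix.PosDef.dotProduct_inv_mulVec_le_s14 {q : ℕ} {W : Matrix (Fin q) (Fin q) ℝ} (hW : W.PosDef)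
    {γ : ℝ} (hγ : 0 < γ) (hle : ∀ v : Fin q → ℝ, γ * (v ⬝ᵥ v) ≤ v ⬝ᵥ W *ᵥ v)
    (z : Fin q → ℝ) : z ⬝ᵥ W⁻¹ *ᵥ z ≤ (z ⬝ᵥ z) / γ := by
  set w := W⁻¹ *ᵥ z with hw
  have hWw : W *ᵥ w = z := by
    rw [hw, mulVec_mulVec, mul_nonsing_inv _ ((isUnit_iff_isUnit_det W).1 hW.isUnit), one_mulVec]
  have h := hle w
  rw [hWw, dotProduct_comm w z] at h
  have h2 := dotProduct_star_self_nonneg (z - γ • w)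
  simp only [star_trivial, sub_dotProduct, dotProduct_sub, smul_dotProduct, dotProduct_smul,
    smul_eq_mul,
    dotProduct_comm w z] at h2
  rw [le_div_iff₀ hγ]
  nlinarith [mul_le_mul_of_nonneg_left h hγ.le]

theorem dotProduct_vecMulVec_self_mulVec {q : ℕ} (z v : Fin q → ℝ) :
    v ⬝ᵥ vecMulVec z z *ᵥ v = (z ⬝ᵥ v) ^ 2 := by
  rw [vecMulVec_mulVec, dotProduct_smul, dotProduct_comm v z]
  simp [sq]

/-- For nonzero spanning data `x₁,…,xₙ`, `0 < γ < 1`, and `u` non-increasing,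
positive on `(0,∞)`, with `s·u(s) ≤ κ` on `(0,∞)` for some `κ ≥ 0` with `(1-γ)κ < 1`,
there exists `c > 0` (independent of the contamination) such that for every contamination
`y₁,…,y_m` and every positive semidefinite solution `V` of the Kullback–Leibler form of the
hybrid M-estimating equation on the combined sample, `c I ≤ V ≤ (γκ/(1-(1-γ)κ)) I`. -/
theorem hybrid_KL_no_breakdown
    (q n m : ℕ) (hq : 0 < q) (hn : 0 < n)
    (x : Fin n → Fin q → ℝ) (hx : ∀ i, x i ≠ 0)
    (hspan : Submodule.span ℝ (Set.range x) = ⊤)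
    (u : ℝ → ℝ) (γ : ℝ) (hγ0 : 0 < γ) (hγ1 : γ < 1)
    (hu_anti : AntitoneOn u (Set.Ioi (0 : ℝ)))
    (hu_pos : ∀ s : ℝ, 0 < s → 0 < u s)
    (κ : ℝ) (hκ0 : 0 ≤ κ) (hκ1 : (1 - γ) * κ < 1)
    (hψ : ∀ s : ℝ, 0 < s → s * u s ≤ κ) :
    ∃ c : ℝ, 0 < c ∧
      ∀ (y : Fin m → Fin q → ℝ) (V : Matrix (Fin q) (Fin q) ℝ),
        V.PosSemidef →
        V = (1 / ((n : ℝ) + m)) •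
            ((∑ i : Fin n,
                u (x i ⬝ᵥ ((1 - γ) • V + γ • (1 : Matrix (Fin q) (Fin q) ℝ))⁻¹ *ᵥ x i) •
                  vecMulVec (x i) (x i))
              + ∑ j : Fin m,
                  u (y j ⬝ᵥ ((1 - γ) • V + γ • (1 : Matrix (Fin q) (Fin q) ℝ))⁻¹ *ᵥ y j) •
                    vecMulVec (y j) (y j)) →
        (V - c • (1 : Matrix (Fin q) (Fin q) ℝ)).PosSemidef ∧
          ((γ * κ / (1 - (1 - γ) * κ)) • (1 : Matrix (Fin q) (Fin q) ℝ) - V).PosSemidef := by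
  have hγκ : 0 < 1 - (1 - γ) * κ := by linarith
  have hself : ∀ z : Fin q → ℝ, z ≠ 0 → 0 < z ⬝ᵥ z := fun z hz => by
    simpa using dotProduct_star_self_pos_iff.2 hz
  have hN : (0 : ℝ) < (n : ℝ) + m := by positivity
  obtain ⟨c, hc, hcoer⟩ := exists_pos_mul_dotProduct_le_sum_sq hq x hspan
    (fun i => u ((x i ⬝ᵥ x i) / γ)) fun i => hu_pos _ (div_pos (hself _ (hx i)) hγ0)
  refine ⟨c / (n + m), div_pos hc hN, fun y V hV hEq => ?_⟩
  have hVnn : ∀ v : Fin q → ℝ, 0 ≤ v ⬝ᵥ V *ᵥ v := fun v => by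
    simpa using hV.dotProduct_mulVec_nonneg v
  have hVT : Vᵀ = V := by simpa [IsHermitian] using hV.isHermitian
  set W := (1 - γ) • V + γ • (1 : Matrix (Fin q) (Fin q) ℝ) with hWdef
  have hWquad : ∀ v : Fin q → ℝ, v ⬝ᵥ W *ᵥ v = (1 - γ) * (v ⬝ᵥ V *ᵥ v) + γ * (v ⬝ᵥ v) := by
    intro v
    simp [hWdef, add_mulVec, smul_mulVec, dotProduct_add]
  have hWpd : W.PosDef :=
    (PosDef.one.smul hγ0).posSemidef_add (hV.smul (sub_nonneg.2 hγ1.le))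
  have hWle : ∀ v : Fin q → ℝ, γ * (v ⬝ᵥ v) ≤ v ⬝ᵥ W *ᵥ v := fun v => by
    rw [hWquad]
    linarith [mul_nonneg (sub_nonneg.2 hγ1.le) (hVnn v)]
  have hspos : ∀ z : Fin q → ℝ, z ≠ 0 → 0 < z ⬝ᵥ W⁻¹ *ᵥ z := fun z hz => by
    simpa using hWpd.inv.dotProduct_mulVec_pos hz
  have hterm : ∀ z v : Fin q → ℝ, 0 ≤ u (z ⬝ᵥ W⁻¹ *ᵥ z) * (z ⬝ᵥ v) ^ 2 ∧
      u (z ⬝ᵥ W⁻¹ *ᵥ z) * (z ⬝ᵥ v) ^ 2 ≤ κ * (v ⬝ᵥ W *ᵥ v) := by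
    intro z v
    have hWv : 0 ≤ v ⬝ᵥ W *ᵥ v := by simpa using hWpd.posSemidef.dotProduct_mulVec_nonneg v
    rcases eq_or_ne z 0 with rfl | hz
    · simpa using mul_nonneg hκ0 hWv
    have hu := hu_pos _ (hspos z hz)
    refine ⟨by positivity, ?_⟩
    calc u (z ⬝ᵥ W⁻¹ *ᵥ z) * (z ⬝ᵥ v) ^ 2
        ≤ u (z ⬝ᵥ W⁻¹ *ᵥ z) * ((z ⬝ᵥ W⁻¹ *ᵥ z) * (v ⬝ᵥ W *ᵥ v)) :=
          mul_le_mul_of_nonneg_left (hWpd.dotProduct_sq_le_s14 z v) hu.le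
      _ = ((z ⬝ᵥ W⁻¹ *ᵥ z) * u (z ⬝ᵥ W⁻¹ *ᵥ z)) * (v ⬝ᵥ W *ᵥ v) := by ring
      _ ≤ κ * (v ⬝ᵥ W *ᵥ v) := mul_le_mul_of_nonneg_right (hψ _ (hspos z hz)) hWv
  have hquad : ∀ v : Fin q → ℝ, ((n : ℝ) + m) * (v ⬝ᵥ V *ᵥ v) =
      (∑ i, u (x i ⬝ᵥ W⁻¹ *ᵥ x i) * (x i ⬝ᵥ v) ^ 2) +
        ∑ j, u (y j ⬝ᵥ W⁻¹ *ᵥ y j) * (y j ⬝ᵥ v) ^ 2 := by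
    intro v
    have h := congrArg (fun A : Matrix (Fin q) (Fin q) ℝ => v ⬝ᵥ A *ᵥ v) hEq
    simp only [smul_mulVec, add_mulVec, sum_mulVec, dotProduct_smul, dotProduct_add,
      dotProduct_sum, dotProduct_vecMulVec_self_mulVec, smul_eq_mul] at h
    rw [h, ← mul_assoc, mul_one_div_cancel hN.ne', one_mul]
  constructor
  · refine posSemidef_of_isSymm_of_forall_dotProduct (by simp [hVT]) fun v => ?_
    have hxle : ∑ i, u ((x i ⬝ᵥ x i) / γ) * (x i ⬝ᵥ v) ^ 2 ≤
        ∑ i, u (x i ⬝ᵥ W⁻¹ *ᵥ x i) * (x i ⬝ᵥ v) ^ 2 :=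
      Finset.sum_le_sum fun i _ => mul_le_mul_of_nonneg_right
        (hu_anti (hspos _ (hx i)) (div_pos (hself _ (hx i)) hγ0)
          (hWpd.dotProduct_inv_mulVec_le_s14 hγ0 hWle (x i))) (sq_nonneg _)
    have hynn : 0 ≤ ∑ j, u (y j ⬝ᵥ W⁻¹ *ᵥ y j) * (y j ⬝ᵥ v) ^ 2 :=
      Finset.sum_nonneg fun j _ => (hterm (y j) v).1
    have hle : c * (v ⬝ᵥ v) ≤ ((n : ℝ) + m) * (v ⬝ᵥ V *ᵥ v) := by
      linarith [hcoer v, hquad v]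
    have : c / (n + m) * (v ⬝ᵥ v) ≤ v ⬝ᵥ V *ᵥ v := by
      rw [div_mul_eq_mul_div, div_le_iff₀ hN]
      linarith
    simpa [sub_mulVec, smul_mulVec, dotProduct_sub] using this
  · refine posSemidef_of_isSymm_of_forall_dotProduct (by simp [hVT]) fun v => ?_
    have hxle : ∑ i, u (x i ⬝ᵥ W⁻¹ *ᵥ x i) * (x i ⬝ᵥ v) ^ 2 ≤ n * (κ * (v ⬝ᵥ W *ᵥ v)) := by
      simpa using Finset.sum_le_sum fun i (_ : i ∈ Finset.univ) => (hterm (x i) v).2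
    have hyle : ∑ j, u (y j ⬝ᵥ W⁻¹ *ᵥ y j) * (y j ⬝ᵥ v) ^ 2 ≤ m * (κ * (v ⬝ᵥ W *ᵥ v)) := by
      simpa using Finset.sum_le_sum fun j (_ : j ∈ Finset.univ) => (hterm (y j) v).2
    have hle : v ⬝ᵥ V *ᵥ v ≤ κ * (v ⬝ᵥ W *ᵥ v) := by
      refine le_of_mul_le_mul_left ?_ hN
      linarith [hquad v]
    have : v ⬝ᵥ V *ᵥ v ≤ γ * κ / (1 - (1 - γ) * κ) * (v ⬝ᵥ v) := by
      rw [div_mul_eq_mul_div, le_div_iff₀ hγκ]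
      rw [hWquad] at hle
      linarith
    simpa [sub_mulVec, smul_mulVec, dotProduct_sub] using this
end

section
/- Let x₁, …, xₙ ∈ ℝ^q be nonzero vectors and let w : ℝ → ℝ be continuous on (0,∞). Let (η_k) be a sequence of positive reals with η_k → ∞, and for each k let V_k be a positive semidefinite q×q matrix satisfying the hybrid M-estimating equation V_k = (1/n) ∑_{i=1}^n w(η_k · xᵢᵀ (V_k + η_k I_q)⁻¹ xᵢ) xᵢ xᵢᵀ. If the sequence (V_k) converges to a matrix V, then V = (1/n) ∑_{i=1}^n w(xᵢᵀ xᵢ) xᵢ xᵢᵀ, i.e., the limit is the general spatial sign covariance matrix with weight w. -/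
open Matrix

/-- If `η k → ∞` and `V k` converges, then `η k • (V k + η k • 1)⁻¹` tends to the identity. -/
theorem tendsto_smul_inv_add_smul_one {m ι : Type*} [Fintype m] [DecidableEq m] {l : Filter ι}
    {η : ι → ℝ} {V : ι → Matrix m m ℝ} {W : Matrix m m ℝ}
    (hη : Filter.Tendsto η l Filter.atTop) (hV : Filter.Tendsto V l (nhds W)) :
    Filter.Tendsto (fun k => η k • (V k + η k • (1 : Matrix m m ℝ))⁻¹) l (nhds 1) := by
  have hB : Filter.Tendsto (fun k => (η k)⁻¹ • V k + 1) l (nhds (1 : Matrix m m ℝ)) := by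
    simpa using ((tendsto_inv_atTop_zero.comp hη).smul hV).add_const (1 : Matrix m m ℝ)
  have hinv : ContinuousAt Inv.inv (1 : Matrix m m ℝ) := by
    apply continuousAt_matrix_inv
    rw [det_one, Ring.inverse_eq_inv']
    exact continuousAt_inv₀ one_ne_zero
  have hdet : ∀ᶠ k in l, ((η k)⁻¹ • V k + 1).det ≠ 0 := by
    have h := (continuous_id.matrix_det.tendsto (1 : Matrix m m ℝ)).comp hB
    exact h.eventually_ne (by simp)
  have hlim := hinv.tendsto.comp hB
  rw [inv_one] at hlim
  refine hlim.congr' ?_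
  filter_upwards [hdet, hη.eventually_gt_atTop 0] with k hk hpos
  have hfac : V k + η k • (1 : Matrix m m ℝ) = η k • ((η k)⁻¹ • V k + 1) := by
    rw [smul_add, smul_inv_smul₀ hpos.ne']
  have hsmul := inv_smul' ((η k)⁻¹ • V k + 1) (Units.mk0 (η k) hpos.ne') hk.isUnit
  simp only [Units.smul_def, Units.val_mk0, Units.val_inv_eq_inv_val] at hsmul
  rw [hfac, hsmul, smul_inv_smul₀ hpos.ne']
  rfl

/-- If `η_k → ∞`, each positive semidefinite `V_k` solves the hybrid
M-estimating equation with weight `u(s) = w(η_k s)`, `w` is continuous on `(0,∞)`, and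
`V_k → W`, then `W = (1/n) ∑ w(xᵢᵀxᵢ) xᵢxᵢᵀ`, the general spatial sign covariance
matrix with weight `w`. -/
theorem hybrid_M_limit_is_general_SSCM
    (q n : ℕ) (hq : 0 < q) (hn : 0 < n)
    (x : Fin n → Fin q → ℝ) (hx : ∀ i, x i ≠ 0)
    (w : ℝ → ℝ) (hw : ContinuousOn w (Set.Ioi (0 : ℝ)))
    (η : ℕ → ℝ) (hηpos : ∀ k, 0 < η k)
    (hηtop : Filter.Tendsto η Filter.atTop Filter.atTop)
    (V : ℕ → Matrix (Fin q) (Fin q) ℝ) (hVpsd : ∀ k, (V k).PosSemidef)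
    (heq : ∀ k, V k = (1 / (n : ℝ)) •
        (∑ i : Fin n,
          w (η k * (x i ⬝ᵥ (V k + η k • (1 : Matrix (Fin q) (Fin q) ℝ))⁻¹ *ᵥ x i)) •
            vecMulVec (x i) (x i)))
    (W : Matrix (Fin q) (Fin q) ℝ)
    (hconv : Filter.Tendsto V Filter.atTop (nhds W)) :
    W = (1 / (n : ℝ)) • (∑ i : Fin n, w (x i ⬝ᵥ x i) • vecMulVec (x i) (x i)) := by
  have hinv := tendsto_smul_inv_add_smul_one hηtop hconv
  refine tendsto_nhds_unique hconv (Filter.Tendsto.congr (fun k => (heq k).symm) ?_)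
  refine (tendsto_finsetSum _ fun i _ => Filter.Tendsto.smul_const ?_ _).const_smul _
  have hpos : 0 < x i ⬝ᵥ x i := by
    simpa using dotProduct_star_self_pos_iff.mpr (hx i)
  refine (hw.continuousAt (Ioi_mem_nhds hpos)).tendsto.comp ?_
  have hquad : Continuous fun A : Matrix (Fin q) (Fin q) ℝ => x i ⬝ᵥ A *ᵥ x i := by
    fun_prop
  simpa [Function.comp_def, smul_mulVec] using (hquad.tendsto 1).comp hinv
end
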